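/- Let ←F_n(q,t) = ∑_{f} q^{area_L(f)} t^{area_U(f)}, the sum over decreasing factorizations f ∈ F_n (those whose lower sequence L(f) is weakly decreasing). Then for all n ≥ 0, ←F_n(q,t) = t^n C_n(q,1); in particular every decreasing factorization f ∈ F_n has area_U(f) = n. -/

import Mathlib

open Finset MvPolynomial

attribute [local instance] Classical.propDecidable

/-- The smaller endpoint of a transposition (as a natural number). -/
def swapLow {m : ℕ} (τ : Equiv.Perm (Fin m)) : ℕ :=
  ((τ.support.image Fin.val).min).getD 0

/-- The larger endpoint of a transposition (as a natural number). -/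
def swapHigh {m : ℕ} (τ : Equiv.Perm (Fin m)) : ℕ :=
  ((τ.support.image Fin.val).max).getD 0

/-- Minimal factorizations of the full cycle `σ_n = (0 1 ⋯ n)` into `n` transpositions.
Permutations are multiplied left to right, i.e. `τ₁τ₂⋯τₙ` sends `x` to `τₙ(⋯τ₂(τ₁(x))⋯)`,
which is the product of the reversed list in Mathlib's convention. -/
def FactSet (n : ℕ) : Set (Fin n → Equiv.Perm (Fin (n+1))) :=
  {f | (∀ i, (f i).IsSwap) ∧ ((List.ofFn f).reverse).prod = finRotate (n+1)}

/-- The lower sequence `L(f) = (a₁, …, aₙ)` of a factorization. -/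
def lowerSeq {n : ℕ} (f : Fin n → Equiv.Perm (Fin (n+1))) : Fin n → ℕ :=
  fun i => swapLow (f i)

/-- The upper sequence `U(f) = (b₁, …, bₙ)` of a factorization. -/
def upperSeq {n : ℕ} (f : Fin n → Equiv.Perm (Fin (n+1))) : Fin n → ℕ :=
  fun i => swapHigh (f i)

/-- The lower area `area_L(f) = C(n,2) - (a₁ + ⋯ + aₙ)`. -/
def areaL {n : ℕ} (f : Fin n → Equiv.Perm (Fin (n+1))) : ℕ :=
  n.choose 2 - ∑ i, swapLow (f i)

/-- The upper area `area_U(f) = (b₁ + ⋯ + bₙ) - C(n,2)`. -/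
def areaU {n : ℕ} (f : Fin n → Equiv.Perm (Fin (n+1))) : ℕ :=
  (∑ i, swapHigh (f i)) - n.choose 2

/-- The `q,t`-Catalan-type polynomials: `C_0(q,t) = 1` and
`C_n(q,t) = ∑_{k=0}^{n-1} q^k t^{n-k-1} C_k(q,t) C_{n-k-1}(q,t)`. -/
noncomputable def Cpoly : ℕ → MvPolynomial (Fin 2) ℤ
  | 0 => 1
  | n + 1 => ∑ k ∈ (Finset.range (n+1)).attach,
      MvPolynomial.X 0 ^ (k : ℕ) * MvPolynomial.X 1 ^ (n - (k : ℕ)) *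
        Cpoly k * Cpoly (n - (k : ℕ))
  decreasing_by
  · exact Finset.mem_range.mp k.2
  · exact Nat.lt_succ_of_le (Nat.sub_le n k)

/-- The bivariate area enumerator of decreasing factorizations (those whose lower
sequence is weakly decreasing):
`←F_n(q,t) = ∑ q^{area_L f} t^{area_U f}`. -/
noncomputable def FdownPoly (n : ℕ) : MvPolynomial (Fin 2) ℤ :=
  ∑ f : {f : Fin n → Equiv.Perm (Fin (n+1)) //
      f ∈ FactSet n ∧ Antitone (lowerSeq f)},
    X 0 ^ areaL f.1 * X 1 ^ areaU f.1

/-- Apply the transpositions `(a b)`, for `(a, b)` in the list, successively from left to right. -/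
def applySwaps : List (ℕ × ℕ) → ℕ → ℕ
  | [], i => i
  | p :: l, i => applySwaps l (Equiv.swap p.1 p.2 i)

theorem applySwaps_append (l l' : List (ℕ × ℕ)) (i : ℕ) :
    applySwaps (l ++ l') i = applySwaps l' (applySwaps l i) := by
  induction l generalizing i with
  | nil => rfl
  | cons p l ih => exact ih _

theorem applySwaps_eq_self {l : List (ℕ × ℕ)} {i : ℕ} (h : ∀ p ∈ l, p.1 ≠ i ∧ p.2 ≠ i) :
    applySwaps l i = i := by
  induction l with
  | nil => rfl
  | cons p l ih =>
    have hp := h p (by simp)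
    rw [applySwaps, Equiv.swap_apply_of_ne_of_ne hp.1.symm hp.2.symm]
    exact ih fun q hq => h q (by simp [hq])

theorem apply_applySwaps {α : Type*} {l : List (ℕ × ℕ)} {c : ℕ → α}
    (h : ∀ p ∈ l, c p.1 = c p.2) (i : ℕ) : c (applySwaps l i) = c i := by
  induction l generalizing i with
  | nil => rfl
  | cons p l ih =>
    have hp := h p (by simp)
    rw [applySwaps, ih fun q hq => h q (by simp [hq])]
    rw [Equiv.swap_apply_def]
    split_ifs <;> simp_all

/-- Merging the endpoints of `m` pairs identifies at most `m` points of a finite set. -/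
theorem exists_coloring_card_le (l : List (ℕ × ℕ)) (S : Finset ℕ) :
    ∃ c : ℕ → ℕ, (∀ p ∈ l, c p.1 = c p.2) ∧ S.card ≤ (S.image c).card + l.length := by
  induction l with
  | nil => exact ⟨id, by simp, by simp⟩
  | cons p l ih =>
    obtain ⟨c, hc, hcard⟩ := ih
    refine ⟨fun i => if c i = c p.2 then c p.1 else c i, ?_, ?_⟩
    · intro q hq
      rcases List.mem_cons.mp hq with rfl | hq
      · simp
      · simp [hc q hq]
    · have hsub : (S.image c).erase (c p.2) ⊆
          S.image (fun i => if c i = c p.2 then c p.1 else c i) := by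
        intro y hy
        obtain ⟨hne, hy⟩ := Finset.mem_erase.mp hy
        obtain ⟨i, hi, rfl⟩ := Finset.mem_image.mp hy
        exact Finset.mem_image.mpr ⟨i, hi, if_neg hne⟩
      have h1 := Finset.card_le_card hsub
      have h2 := Finset.pred_card_le_card_erase (s := S.image c) (a := c p.2)
      simp only [List.length_cons]
      lia

/-- A list of pairs encoding a decreasing minimal factorization of the cycle
`(s, s + 1, …, s + n)` into transpositions. -/
structure IsDecFact (s n : ℕ) (l : List (ℕ × ℕ)) : Prop where
  bounds : ∀ p ∈ l, s ≤ p.1 ∧ p.1 < p.2 ∧ p.2 ≤ s + n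
  length_eq : l.length = n
  pairwise : l.Pairwise fun p q => q.1 ≤ p.1
  apply_of_lt : ∀ i, s ≤ i → i < s + n → applySwaps l i = i + 1
  apply_last : applySwaps l (s + n) = s

/-- The decreasing factorization of the cycle `(s, …, s + t.numNodes)` encoded by a binary
tree `t`. -/
def factOfTree : ℕ → BinaryTree Unit → List (ℕ × ℕ)
  | _, .nil => []
  | s, .node _ l r =>
    factOfTree (s + l.numNodes + 1) r ++ factOfTree s l ++ [(s, s + l.numNodes + 1)]

theorem isDecFact_nil (s : ℕ) : IsDecFact s 0 [] :=
  ⟨by simp, rfl, List.Pairwise.nil, fun i h h' => absurd h' (by lia), rfl⟩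

theorem IsDecFact.join {s k m : ℕ} {l₁ l₂ : List (ℕ × ℕ)} (h₁ : IsDecFact s k l₁)
    (h₂ : IsDecFact (s + k + 1) m l₂) :
    IsDecFact s (k + m + 1) (l₂ ++ l₁ ++ [(s, s + k + 1)]) := by
  have b₁ := h₁.bounds
  have b₂ := h₂.bounds
  have fix₁ : ∀ i, s + k < i → applySwaps l₁ i = i := fun i hi =>
    applySwaps_eq_self fun p hp => by have := b₁ p hp; lia
  have fix₂ : ∀ i, i < s + k + 1 → applySwaps l₂ i = i := fun i hi =>
    applySwaps_eq_self fun p hp => by have := b₂ p hp; lia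
  refine ⟨?_, ?_, ?_, ?_, ?_⟩
  · intro p hp
    simp only [List.mem_append, List.mem_singleton] at hp
    rcases hp with (hp | hp) | rfl
    · have := b₂ p hp; lia
    · have := b₁ p hp; lia
    · simp only; lia
  · simp [h₁.length_eq, h₂.length_eq]; lia
  · rw [List.pairwise_append, List.pairwise_append]
    refine ⟨⟨h₂.pairwise, h₁.pairwise, fun p hp q hq => ?_⟩, List.pairwise_singleton _ _, ?_⟩
    · have := b₂ p hp; have := b₁ q hq; lia
    · intro p hp q hq
      rw [List.mem_singleton] at hq
      subst hq
      rcases List.mem_append.mp hp with hp | hp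
      · have := b₂ p hp; simp only; lia
      · exact (b₁ p hp).1
  · intro i hi hi'
    simp only [applySwaps_append, applySwaps]
    rcases lt_trichotomy i (s + k) with h | rfl | h
    · rw [fix₂ i (by lia), h₁.apply_of_lt i hi h, Equiv.swap_apply_of_ne_of_ne] <;> lia
    · rw [fix₂ _ (by lia), h₁.apply_last, Equiv.swap_apply_left]
    · rw [h₂.apply_of_lt i (by lia) (by lia), fix₁ _ (by lia),
        Equiv.swap_apply_of_ne_of_ne] <;> lia
  · simp only [applySwaps_append, applySwaps]
    rw [show s + (k + m + 1) = s + k + 1 + m by lia, h₂.apply_last, fix₁ _ (by lia),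
      Equiv.swap_apply_right]

theorem isDecFact_factOfTree (s : ℕ) (t : BinaryTree Unit) :
    IsDecFact s t.numNodes (factOfTree s t) := by
  induction t generalizing s with
  | nil => exact isDecFact_nil s
  | node _ l r ihl ihr => exact (ihl s).join (ihr _)

theorem factOfTree_injective (s : ℕ) : Function.Injective (factOfTree s) := by
  intro t
  induction t generalizing s with
  | nil =>
    intro t' h
    cases t' with
    | nil => rfl
    | node _ l r => simp [factOfTree] at h
  | node _ l r ihl ihr =>
    intro t' h
    cases t' with
    | nil => simp [factOfTree] at h
    | node _ l' r' =>
      simp only [factOfTree] at h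
      obtain ⟨h, hlast⟩ := List.append_inj' h rfl
      have hn : l.numNodes = l'.numNodes := by simpa using hlast
      rw [hn] at h
      obtain ⟨hr, hl⟩ := List.append_inj' h (by
        rw [(isDecFact_factOfTree s l).length_eq, (isDecFact_factOfTree s l').length_eq, hn])
      rw [ihl _ hl, ihr _ hr]

theorem filter_append_filter_of_pairwise {l : List (ℕ × ℕ)} (b : ℕ)
    (h : l.Pairwise fun p q => q.1 ≤ p.1) :
    l.filter (fun p => b ≤ p.1) ++ l.filter (fun p => p.1 < b) = l := by
  induction l with
  | nil => rfl
  | cons p l ih =>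
    obtain ⟨hp, hl⟩ := List.pairwise_cons.mp h
    by_cases hb : b ≤ p.1
    · simp [hb, Nat.not_lt.mpr hb, ih hl]
    · have h1 : l.filter (fun q => b ≤ q.1) = [] := by
        rw [List.filter_eq_nil_iff]
        intro q hq
        have := hp q hq
        simp only [decide_eq_true_eq]; lia
      have h2 := ih hl
      rw [h1, List.nil_append] at h2
      simp [hb, h1, h2, Nat.lt_of_not_le hb]

/-- A list of transpositions whose product moves `i` to `i + 1` for `s ≤ i < s + n` has at least
`n` terms. -/
theorem le_length_of_applySwaps {s n : ℕ} {l : List (ℕ × ℕ)}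
    (h : ∀ i, s ≤ i → i < s + n → applySwaps l i = i + 1) : n ≤ l.length := by
  obtain ⟨c, hc, hcard⟩ := exists_coloring_card_le l (Finset.Icc s (s + n))
  have hconst : ∀ j ≤ n, c (s + j) = c s := by
    intro j hj
    induction j with
    | zero => rfl
    | succ j ih =>
      rw [← ih (by lia), ← apply_applySwaps hc (s + j), h _ (by lia) (by lia), add_assoc]
  have himg : (Finset.Icc s (s + n)).image c ⊆ {c s} := by
    intro y hy
    obtain ⟨i, hi, rfl⟩ := Finset.mem_image.mp hy
    rw [Finset.mem_Icc] at hi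
    rw [Finset.mem_singleton, ← hconst (i - s) (by lia)]
    congr 1; lia
  have := Finset.card_le_card himg
  simp only [Nat.card_Icc, Finset.card_singleton] at hcard this
  lia

/-- If a product of `k + m` transpositions acts on `[s, s + k + m + 1]` with the two cycles
`[s, s + k]` and `[s + k + 1, s + k + m + 1]`, then no transposition joins the two cycles. -/
theorem same_side_of_applySwaps {s k m : ℕ} {l : List (ℕ × ℕ)} (hlen : l.length = k + m)
    (hbd : ∀ p ∈ l, s ≤ p.1 ∧ p.1 < p.2 ∧ p.2 ≤ s + k + 1 + m)
    (h₁ : ∀ i, s ≤ i → i < s + k → applySwaps l i = i + 1)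
    (h₂ : ∀ i, s + k + 1 ≤ i → i < s + k + 1 + m → applySwaps l i = i + 1) :
    ∀ p ∈ l, p.1 < s + k + 1 → p.2 < s + k + 1 := by
  obtain ⟨c, hc, hcard⟩ := exists_coloring_card_le l (Finset.Icc s (s + k + 1 + m))
  have hc₁ : ∀ j ≤ k, c (s + j) = c s := by
    intro j hj
    induction j with
    | zero => rfl
    | succ j ih =>
      rw [← ih (by lia), ← apply_applySwaps hc (s + j), h₁ _ (by lia) (by lia), add_assoc]
  have hc₂ : ∀ j ≤ m, c (s + k + 1 + j) = c (s + k + 1) := by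
    intro j hj
    induction j with
    | zero => rfl
    | succ j ih =>
      rw [← ih (by lia), ← apply_applySwaps hc (s + k + 1 + j), h₂ _ (by lia) (by lia),
        ← add_assoc]
  have hc₁' : ∀ i, s ≤ i → i < s + k + 1 → c i = c s := fun i hi hi' => by
    rw [← hc₁ (i - s) (by lia)]; congr 1; lia
  have hc₂' : ∀ i, s + k + 1 ≤ i → i ≤ s + k + 1 + m → c i = c (s + k + 1) :=
    fun i hi hi' => by rw [← hc₂ (i - (s + k + 1)) (by lia)]; congr 1; lia
  intro p hp hp₁
  by_contra hp₂
  have hb := hbd p hp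
  have heq : c (s + k + 1) = c s := by
    rw [← hc₁' p.1 hb.1 hp₁, ← hc₂' p.2 (by lia) hb.2.2, hc p hp]
  have himg : (Finset.Icc s (s + k + 1 + m)).image c ⊆ {c s} := by
    intro y hy
    obtain ⟨i, hi, rfl⟩ := Finset.mem_image.mp hy
    rw [Finset.mem_Icc] at hi
    rw [Finset.mem_singleton]
    rcases lt_or_ge i (s + k + 1) with h | h
    · exact hc₁' i hi.1 h
    · rw [hc₂' i h hi.2, heq]
  have := Finset.card_le_card himg
  simp only [Nat.card_Icc, Finset.card_singleton] at hcard this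
  lia

theorem isDecFact_filter_low_high {s k m : ℕ} {l : List (ℕ × ℕ)} (hlen : l.length = k + m)
    (hbd : ∀ p ∈ l, s ≤ p.1 ∧ p.1 < p.2 ∧ p.2 ≤ s + k + 1 + m)
    (hpw : l.Pairwise fun p q => q.1 ≤ p.1)
    (h₁ : ∀ i, s ≤ i → i < s + k → applySwaps l i = i + 1)
    (h₁' : applySwaps l (s + k) = s)
    (h₂ : ∀ i, s + k + 1 ≤ i → i < s + k + 1 + m → applySwaps l i = i + 1)
    (h₂' : applySwaps l (s + k + 1 + m) = s + k + 1) :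
    IsDecFact s k (l.filter fun p => p.1 < s + k + 1) ∧
      IsDecFact (s + k + 1) m (l.filter fun p => s + k + 1 ≤ p.1) := by
  have hside := same_side_of_applySwaps hlen hbd h₁ h₂
  have happ := filter_append_filter_of_pairwise (s + k + 1) hpw
  have hpw₁ := hpw.filter (fun p => p.1 < s + k + 1)
  have hpw₂ := hpw.filter (fun p => s + k + 1 ≤ p.1)
  have b₁ : ∀ p ∈ l.filter (fun p => p.1 < s + k + 1), s ≤ p.1 ∧ p.1 < p.2 ∧ p.2 ≤ s + k := by
    intro p hp
    simp only [List.mem_filter, decide_eq_true_eq] at hp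
    have := hside p hp.1 hp.2
    have := hbd p hp.1
    lia
  have b₂ : ∀ p ∈ l.filter (fun p => s + k + 1 ≤ p.1),
      s + k + 1 ≤ p.1 ∧ p.1 < p.2 ∧ p.2 ≤ s + k + 1 + m := by
    intro p hp
    simp only [List.mem_filter, decide_eq_true_eq] at hp
    have := hbd p hp.1
    lia
  generalize l.filter (fun p => p.1 < s + k + 1) = l₁ at *
  generalize l.filter (fun p => s + k + 1 ≤ p.1) = l₂ at *
  subst happ
  simp only [applySwaps_append] at h₁ h₁' h₂ h₂'
  have fix₂ : ∀ i, i < s + k + 1 → applySwaps l₂ i = i := fun i hi =>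
    applySwaps_eq_self fun p hp => by have := b₂ p hp; lia
  have fix₁ : ∀ i, s + k + 1 ≤ i → applySwaps l₁ (applySwaps l₂ i) = applySwaps l₂ i := by
    intro i hi
    have hstay : (applySwaps l₂ i < s + k + 1) = (i < s + k + 1) :=
      apply_applySwaps (c := fun j => j < s + k + 1)
        (fun p hp => by have := b₂ p hp; simp only [eq_iff_iff]; lia) i
    have hge : ¬ applySwaps l₂ i < s + k + 1 := by rw [hstay]; lia
    exact applySwaps_eq_self fun p hp => by have := b₁ p hp; lia
  have g₁ : ∀ i, s ≤ i → i < s + k → applySwaps l₁ i = i + 1 := fun i hi hi' => by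
    rw [← h₁ i hi hi', fix₂ i (by lia)]
  have g₂ : ∀ i, s + k + 1 ≤ i → i < s + k + 1 + m → applySwaps l₂ i = i + 1 :=
    fun i hi hi' => by rw [← h₂ i hi hi', fix₁ i hi]
  have n₁ := le_length_of_applySwaps g₁
  have n₂ := le_length_of_applySwaps g₂
  rw [List.length_append] at hlen
  refine ⟨⟨b₁, by lia, hpw₁, g₁, ?_⟩, ⟨b₂, by lia, hpw₂, g₂, ?_⟩⟩
  · rw [fix₂ _ (by lia)] at h₁'; exact h₁'
  · rw [fix₁ _ (by lia)] at h₂'; exact h₂'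

theorem IsDecFact.exists_join {s n : ℕ} {l : List (ℕ × ℕ)} (h : IsDecFact s (n + 1) l) :
    ∃ k m l₁ l₂, n = k + m ∧ IsDecFact s k l₁ ∧ IsDecFact (s + k + 1) m l₂ ∧
      l = l₂ ++ l₁ ++ [(s, s + k + 1)] := by
  rcases List.eq_nil_or_concat' l with rfl | ⟨l', ⟨a, b⟩, rfl⟩
  · exact absurd h.length_eq (by simp)
  have hbd := h.bounds
  have hpw := List.pairwise_append.mp h.pairwise
  have hab := hbd (a, b) (by simp)
  simp only at hab
  have ha : a = s := by
    by_contra hne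
    have := h.apply_of_lt s le_rfl (by lia)
    rw [applySwaps_eq_self] at this
    · lia
    · intro p hp
      have hb := hbd p hp
      have : a ≤ p.1 := by
        rcases List.mem_append.mp hp with hp | hp
        · exact hpw.2.2 p hp (a, b) (by simp)
        · rw [List.mem_singleton.mp hp]
      lia
  subst ha
  obtain ⟨k, rfl⟩ : ∃ k, b = a + k + 1 := ⟨b - a - 1, by lia⟩
  obtain ⟨m, rfl⟩ : ∃ m, n = k + m := ⟨n - k, by lia⟩
  have hsw : ∀ i j, applySwaps (l' ++ [(a, a + k + 1)]) i = j →
      applySwaps l' i = Equiv.swap a (a + k + 1) j := by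
    rintro i _ rfl
    simp [applySwaps_append, applySwaps]
  obtain ⟨d₁, d₂⟩ := isDecFact_filter_low_high (s := a) (k := k) (m := m) (l := l')
    (by simpa using h.length_eq)
    (fun p hp => by have := hbd p (by simp [hp]); lia) hpw.1
    (fun i hi hi' => by
      rw [hsw _ _ (h.apply_of_lt i hi (by lia)), Equiv.swap_apply_of_ne_of_ne] <;> lia)
    (by rw [hsw _ _ (h.apply_of_lt (a + k) (by lia) (by lia)), Equiv.swap_apply_right])
    (fun i hi hi' => by
      rw [hsw _ _ (h.apply_of_lt i (by lia) (by lia)), Equiv.swap_apply_of_ne_of_ne] <;> lia)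
    (by
      rw [show a + k + 1 + m = a + (k + m + 1) by lia, hsw _ _ h.apply_last,
        Equiv.swap_apply_left])
  exact ⟨k, m, _, _, rfl, d₁, d₂, by rw [filter_append_filter_of_pairwise _ hpw.1]⟩

theorem IsDecFact.exists_factOfTree_eq {s n : ℕ} {l : List (ℕ × ℕ)} (h : IsDecFact s n l) :
    ∃ t : BinaryTree Unit, t.numNodes = n ∧ factOfTree s t = l := by
  induction n using Nat.strong_induction_on generalizing s l with
  | _ n ih =>
    cases n with
    | zero => exact ⟨.nil, rfl, (List.length_eq_zero_iff.mp h.length_eq).symm⟩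
    | succ n =>
      obtain ⟨k, m, l₁, l₂, rfl, h₁, h₂, rfl⟩ := h.exists_join
      obtain ⟨t₁, rfl, rfl⟩ := ih k (by lia) h₁
      obtain ⟨t₂, rfl, rfl⟩ := ih m (by lia) h₂
      exact ⟨.node () t₁ t₂, rfl, rfl⟩

/-- The lower area of the decreasing factorization encoded by a binary tree. -/
def treeArea : BinaryTree Unit → ℕ
  | .nil => 0
  | .node _ l r => l.numNodes + treeArea l + treeArea r

theorem choose_two_add_add_one (k m : ℕ) :
    (k + m + 1).choose 2 = k.choose 2 + m.choose 2 + k * m + k + m := by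
  have h : ((k + m + 1).choose 2 : ℚ) = k.choose 2 + m.choose 2 + k * m + k + m := by
    simp only [Nat.cast_choose_two]
    push_cast
    ring
  exact_mod_cast h

theorem sum_fst_factOfTree (s : ℕ) (t : BinaryTree Unit) :
    ((factOfTree s t).map Prod.fst).sum + treeArea t =
      s * t.numNodes + t.numNodes.choose 2 := by
  induction t generalizing s with
  | nil => simp [factOfTree, treeArea, BinaryTree.numNodes]
  | node _ l r ihl ihr =>
    have hl := ihl s
    have hr := ihr (s + l.numNodes + 1)
    simp only [factOfTree, treeArea, BinaryTree.numNodes, List.map_append, List.sum_append,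
      List.map_cons, List.map_nil, List.sum_singleton, choose_two_add_add_one]
    linear_combination hl + hr

theorem sum_snd_factOfTree (s : ℕ) (t : BinaryTree Unit) :
    ((factOfTree s t).map Prod.snd).sum =
      s * t.numNodes + t.numNodes.choose 2 + t.numNodes := by
  induction t generalizing s with
  | nil => simp [factOfTree, BinaryTree.numNodes]
  | node _ l r ihl ihr =>
    simp only [factOfTree, BinaryTree.numNodes, List.map_append, List.sum_append,
      List.map_cons, List.map_nil, List.sum_singleton, choose_two_add_add_one, ihl, ihr]
    ring

theorem support_swap_image_val {m : ℕ} {x y : Fin m} (h : x < y) :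
    (Equiv.swap x y).support.image Fin.val = {x.val, y.val} := by
  rw [Equiv.Perm.support_swap h.ne]
  simp

theorem swapLow_swap {m : ℕ} {x y : Fin m} (h : x < y) : swapLow (Equiv.swap x y) = x := by
  have hxy : (x : ℕ) < y := h
  rw [swapLow, support_swap_image_val h, Finset.min_insert, Finset.min_singleton,
    min_eq_left (WithTop.coe_le_coe.mpr hxy.le)]
  rfl

theorem swapHigh_swap {m : ℕ} {x y : Fin m} (h : x < y) : swapHigh (Equiv.swap x y) = y := by
  have hxy : (x : ℕ) < y := h
  rw [swapHigh, support_swap_image_val h, Finset.max_insert, Finset.max_singleton,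
    max_eq_right (WithBot.coe_le_coe.mpr hxy.le)]
  rfl

theorem Equiv.Perm.IsSwap.exists_lt {m : ℕ} {τ : Equiv.Perm (Fin m)} (h : τ.IsSwap) :
    ∃ x y : Fin m, x < y ∧ τ = Equiv.swap x y := by
  obtain ⟨x, y, hne, h⟩ := h
  rcases hne.lt_or_gt with hlt | hlt
  · exact ⟨x, y, hlt, by convert h⟩
  · exact ⟨y, x, hlt, by rw [Equiv.swap_comm]; convert h⟩

/-- The pair of endpoints of a transposition. -/
def swapPair {m : ℕ} (τ : Equiv.Perm (Fin m)) : ℕ × ℕ :=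
  (swapLow τ, swapHigh τ)

theorem swapPair_swap {m : ℕ} {x y : Fin m} (h : x < y) :
    swapPair (Equiv.swap x y) = (x.val, y.val) := by
  rw [swapPair, swapLow_swap h, swapHigh_swap h]

theorem val_reverse_prod_apply {m : ℕ} {L : List (Equiv.Perm (Fin m))}
    (h : ∀ τ ∈ L, τ.IsSwap) (i : Fin m) :
    (L.reverse.prod i : ℕ) = applySwaps (L.map swapPair) i := by
  induction L generalizing i with
  | nil => rfl
  | cons τ L ih =>
    obtain ⟨x, y, hxy, rfl⟩ := (h τ (by simp)).exists_lt
    rw [List.reverse_cons, List.prod_append, List.prod_singleton, Equiv.Perm.mul_apply,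
      ih fun σ hσ => h σ (by simp [hσ]), List.map_cons, applySwaps, swapPair_swap hxy]
    congr 1
    simp only [Equiv.swap_apply_def, Fin.ext_iff]
    split_ifs <;> rfl

/-- The list of endpoint pairs of a sequence of transpositions. -/
def pairList {n m : ℕ} (f : Fin n → Equiv.Perm (Fin m)) : List (ℕ × ℕ) :=
  (List.ofFn f).map swapPair

theorem pairList_eq_ofFn {n m : ℕ} (f : Fin n → Equiv.Perm (Fin m)) :
    pairList f = List.ofFn fun i => swapPair (f i) := by
  rw [pairList, List.map_ofFn]
  rfl

theorem eq_of_pairList_eq {n m : ℕ} {f g : Fin n → Equiv.Perm (Fin m)}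
    (hf : ∀ i, (f i).IsSwap) (hg : ∀ i, (g i).IsSwap) (h : pairList f = pairList g) :
    f = g := by
  rw [pairList_eq_ofFn, pairList_eq_ofFn] at h
  have h' := List.ofFn_injective h
  funext i
  have hi := congrFun h' i
  obtain ⟨x, y, hxy, hx⟩ := (hf i).exists_lt
  obtain ⟨u, v, huv, hu⟩ := (hg i).exists_lt
  simp only [hx, hu, swapPair_swap hxy, swapPair_swap huv, Prod.mk.injEq,
    Fin.val_inj] at hi
  rw [hx, hu, hi.1, hi.2]

theorem antitone_lowerSeq_iff {n : ℕ} (f : Fin n → Equiv.Perm (Fin (n + 1))) :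
    Antitone (lowerSeq f) ↔ (pairList f).Pairwise fun p q => q.1 ≤ p.1 := by
  rw [pairList_eq_ofFn, List.pairwise_ofFn]
  refine ⟨fun h i j hij => h hij.le, fun h i j hij => ?_⟩
  rcases hij.eq_or_lt with rfl | hij
  · exact le_rfl
  · exact h hij

theorem reverse_prod_eq_finRotate_iff {n : ℕ} {f : Fin n → Equiv.Perm (Fin (n + 1))}
    (hf : ∀ i, (f i).IsSwap) :
    (List.ofFn f).reverse.prod = finRotate (n + 1) ↔
      (∀ i < n, applySwaps (pairList f) i = i + 1) ∧ applySwaps (pairList f) n = 0 := by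
  have hval := val_reverse_prod_apply (L := List.ofFn f) (by simpa [List.mem_ofFn] using hf)
  constructor
  · intro h
    rw [h] at hval
    refine ⟨fun i hi => ?_, ?_⟩
    · rw [pairList, ← hval ⟨i, by lia⟩, finRotate_of_lt hi]
    · rw [pairList, ← hval ⟨n, by lia⟩, finRotate_last']
  · rintro ⟨h₁, h₂⟩
    ext ⟨i, hi⟩
    rw [hval]
    rcases (Nat.lt_succ_iff.mp hi).lt_or_eq with h | rfl
    · rw [finRotate_of_lt h]
      exact h₁ i h
    · rw [finRotate_last']
      exact h₂

theorem isDecFact_pairList {n : ℕ} {f : Fin n → Equiv.Perm (Fin (n + 1))}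
    (hf : f ∈ FactSet n) (ha : Antitone (lowerSeq f)) : IsDecFact 0 n (pairList f) := by
  obtain ⟨hs, hprod⟩ := hf
  obtain ⟨h₁, h₂⟩ := (reverse_prod_eq_finRotate_iff hs).mp hprod
  refine ⟨?_, by simp [pairList], (antitone_lowerSeq_iff f).mp ha,
    fun i _ hi => h₁ i (by lia), by simpa using h₂⟩
  intro p hp
  rw [pairList_eq_ofFn, List.mem_ofFn] at hp
  obtain ⟨i, rfl⟩ := hp
  obtain ⟨x, y, hxy, h⟩ := (hs i).exists_lt
  simp only [h, swapPair_swap hxy]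
  have : (x : ℕ) < y := hxy
  lia

theorem IsDecFact.exists_pairList_eq {n : ℕ} {l : List (ℕ × ℕ)} (h : IsDecFact 0 n l) :
    ∃ f : Fin n → Equiv.Perm (Fin (n + 1)),
      (f ∈ FactSet n ∧ Antitone (lowerSeq f)) ∧ pairList f = l := by
  have hmem : ∀ i : Fin n, i < l.length := fun i => by rw [h.length_eq]; exact i.2
  have hb : ∀ i : Fin n, (l[i]'(hmem i)).1 < (l[i]'(hmem i)).2 ∧ (l[i]'(hmem i)).2 < n + 1 :=
    fun i => by have := h.bounds _ (List.getElem_mem (hmem i)); simp only [Fin.getElem_fin]; lia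
  let x : Fin n → Fin (n + 1) := fun i => ⟨(l[i]'(hmem i)).1, (hb i).1.trans (hb i).2⟩
  let y : Fin n → Fin (n + 1) := fun i => ⟨(l[i]'(hmem i)).2, (hb i).2⟩
  have hxy : ∀ i, x i < y i := fun i => (hb i).1
  have hs : ∀ i, (Equiv.swap (x i) (y i)).IsSwap := fun i =>
    ⟨x i, y i, (hxy i).ne, by congr⟩
  have hl : pairList (fun i => Equiv.swap (x i) (y i)) = l := by
    rw [pairList_eq_ofFn]
    refine List.ext_getElem (by simp [h.length_eq]) fun i _ _ => ?_
    rw [List.getElem_ofFn, swapPair_swap (hxy _)]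
    rfl
  refine ⟨fun i => Equiv.swap (x i) (y i), ⟨⟨hs, ?_⟩, ?_⟩, hl⟩
  · rw [reverse_prod_eq_finRotate_iff hs, hl]
    exact ⟨fun i hi => h.apply_of_lt i (by lia) (by lia), by simpa using h.apply_last⟩
  · rw [antitone_lowerSeq_iff, hl]
    exact h.pairwise

theorem sum_swapLow_eq {n m : ℕ} (f : Fin n → Equiv.Perm (Fin m)) :
    ∑ i, swapLow (f i) = ((pairList f).map Prod.fst).sum := by
  rw [pairList_eq_ofFn, List.map_ofFn, List.sum_ofFn]
  rfl

theorem sum_swapHigh_eq {n m : ℕ} (f : Fin n → Equiv.Perm (Fin m)) :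
    ∑ i, swapHigh (f i) = ((pairList f).map Prod.snd).sum := by
  rw [pairList_eq_ofFn, List.map_ofFn, List.sum_ofFn]
  rfl

theorem areaL_eq_treeArea {n : ℕ} {f : Fin n → Equiv.Perm (Fin (n + 1))}
    {t : BinaryTree Unit} (ht : t.numNodes = n) (h : factOfTree 0 t = pairList f) :
    areaL f = treeArea t := by
  have := sum_fst_factOfTree 0 t
  rw [h, ht] at this
  rw [areaL, sum_swapLow_eq]
  lia

theorem areaU_eq_of_factOfTree {n : ℕ} {f : Fin n → Equiv.Perm (Fin (n + 1))}
    {t : BinaryTree Unit} (ht : t.numNodes = n) (h : factOfTree 0 t = pairList f) :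
    areaU f = n := by
  have := sum_snd_factOfTree 0 t
  rw [h, ht] at this
  rw [areaU, sum_swapHigh_eq]
  lia

theorem areaU_eq_of_antitone {n : ℕ} {f : Fin n → Equiv.Perm (Fin (n + 1))}
    (hf : f ∈ FactSet n) (ha : Antitone (lowerSeq f)) : areaU f = n := by
  obtain ⟨t, ht, h⟩ := (isDecFact_pairList hf ha).exists_factOfTree_eq
  exact areaU_eq_of_factOfTree ht h

theorem FdownPoly_eq_sum_trees (n : ℕ) :
    FdownPoly n =
      ∑ t ∈ BinaryTree.treesOfNumNodesEq n, X 0 ^ treeArea t * X 1 ^ n := by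
  symm
  have key : ∀ t ∈ BinaryTree.treesOfNumNodesEq n,
      ∃ f : {f : Fin n → Equiv.Perm (Fin (n + 1)) // f ∈ FactSet n ∧ Antitone (lowerSeq f)},
        pairList f.1 = factOfTree 0 t := fun t ht => by
    have hd := isDecFact_factOfTree 0 t
    rw [BinaryTree.mem_treesOfNumNodesEq.mp ht] at hd
    obtain ⟨f, hf, h⟩ := hd.exists_pairList_eq
    exact ⟨⟨f, hf⟩, h⟩
  choose F hF using key
  refine Finset.sum_bij F (fun _ _ => Finset.mem_univ _) ?_ ?_ ?_
  · intro t ht t' ht' h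
    exact factOfTree_injective 0 (by rw [← hF t ht, ← hF t' ht', h])
  · rintro ⟨f, hf, ha⟩ -
    obtain ⟨t, ht, h⟩ := (isDecFact_pairList hf ha).exists_factOfTree_eq
    have ht := BinaryTree.mem_treesOfNumNodesEq.mpr ht
    refine ⟨t, ht, Subtype.ext (eq_of_pairList_eq (F t ht).2.1.1 hf.1 ?_)⟩
    rw [hF, h]
  · intro t ht
    have hn := BinaryTree.mem_treesOfNumNodesEq.mp ht
    rw [areaL_eq_treeArea hn (hF t ht).symm, areaU_eq_of_factOfTree hn (hF t ht).symm]

theorem sum_treesOfNumNodesEq_succ {M : Type*} [AddCommMonoid M] (n : ℕ)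
    (g : BinaryTree Unit → M) :
    ∑ t ∈ BinaryTree.treesOfNumNodesEq (n + 1), g t =
      ∑ ij ∈ Finset.HasAntidiagonal.antidiagonal n, ∑ l ∈ BinaryTree.treesOfNumNodesEq ij.1,
        ∑ r ∈ BinaryTree.treesOfNumNodesEq ij.2, g (.node () l r) := by
  rw [BinaryTree.treesOfNumNodesEq_succ, Finset.sum_biUnion]
  · refine Finset.sum_congr rfl fun ij _ => ?_
    rw [Finset.sum_map, Finset.sum_product]
    rfl
  · rintro ⟨i, j⟩ _ ⟨i', j'⟩ _ hne
    rw [Function.onFun, Finset.disjoint_left]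
    intro t ht ht'
    simp only [Finset.mem_map, Finset.mem_product, BinaryTree.mem_treesOfNumNodesEq] at ht ht'
    obtain ⟨⟨a, b⟩, ⟨rfl, rfl⟩, rfl⟩ := ht
    obtain ⟨⟨a', b'⟩, ⟨rfl, rfl⟩, h⟩ := ht'
    obtain ⟨-, rfl, rfl⟩ := BinaryTree.node.inj h
    exact hne rfl

theorem aeval_Cpoly_eq_sum_trees (n : ℕ) :
    aeval (fun i : Fin 2 => if i = 0 then (X 0 : MvPolynomial (Fin 2) ℤ) else 1) (Cpoly n) =
      ∑ t ∈ BinaryTree.treesOfNumNodesEq n, X 0 ^ treeArea t := by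
  induction n using Nat.strong_induction_on with
  | _ n ih =>
    cases n with
    | zero => simp [Cpoly, treeArea]
    | succ n =>
      rw [Cpoly, sum_treesOfNumNodesEq_succ, Finset.Nat.sum_antidiagonal_eq_sum_range_succ_mk,
        map_sum, Finset.sum_attach (Finset.range (n + 1)) (fun k => aeval _
          (X 0 ^ k * X 1 ^ (n - k) * Cpoly k * Cpoly (n - k)))]
      refine Finset.sum_congr rfl fun k hk => ?_
      have hk' := Finset.mem_range.mp hk
      simp only [map_mul, map_pow, aeval_X, if_true, one_ne_zero, if_false, one_pow, mul_one,
        ih k hk', ih (n - k) (by lia)]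
      rw [mul_assoc, Finset.sum_mul_sum, Finset.mul_sum]
      refine Finset.sum_congr rfl fun l hl => ?_
      rw [Finset.mul_sum]
      refine Finset.sum_congr rfl fun r _ => ?_
      rw [treeArea, BinaryTree.mem_treesOfNumNodesEq.mp hl, pow_add, pow_add, mul_assoc]

/-- For all `n ≥ 0`, `←F_n(q,t) = tⁿ C_n(q,1)` (the specialization `t := 1` of the
`q,t`-Catalan polynomial, i.e. the Carlitz–Riordan `q`-Catalan polynomial); in
particular every decreasing factorization `f ∈ F_n` has `area_U(f) = n`. -/
theorem FdownPoly_eq_and_areaU (n : ℕ) :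
    FdownPoly n =
      X 1 ^ n * (aeval (fun i : Fin 2 => if i = 0 then (X 0 : MvPolynomial (Fin 2) ℤ)
        else 1) (Cpoly n)) ∧
    ∀ f : Fin n → Equiv.Perm (Fin (n+1)),
      f ∈ FactSet n → Antitone (lowerSeq f) → areaU f = n := by
  refine ⟨?_, fun f hf ha => areaU_eq_of_antitone hf ha⟩
  rw [FdownPoly_eq_sum_trees, aeval_Cpoly_eq_sum_trees, Finset.mul_sum]
  exact Finset.sum_congr rfl fun t _ => mul_comm _ _
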